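/- Every natural number n with n > 1674 belongs to the set A = {10a + 11b : a ≥ 1, b ≥ 2a+1, gcd(a,b) = 1}. -/

import Mathlib

def A : Set ℕ := {n | ∃ a b : ℕ, n = 10 * a + 11 * b ∧ 1 ≤ a ∧ 2 * a + 1 ≤ b ∧ Nat.gcd a b = 1}

theorem mem_A_of_coprime {n s : ℕ} (hlow : n < 11 * s) (hupp : 32 * s < 3 * n)
    (hs : s.Coprime n) : n ∈ A := by
  refine ⟨11 * s - n, n - 10 * s, by omega, by omega, by omega, ?_⟩
  have hd : Nat.gcd (11 * s - n) (n - 10 * s) ∣ Nat.gcd s n := by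
    have h₁ := Nat.gcd_dvd_left (11 * s - n) (n - 10 * s)
    have h₂ := Nat.gcd_dvd_right (11 * s - n) (n - 10 * s)
    have hdvd : Nat.gcd (11 * s - n) (n - 10 * s) ∣ s := by
      have h := dvd_add h₁ h₂
      rwa [show 11 * s - n + (n - 10 * s) = s by omega] at h
    refine Nat.dvd_gcd hdvd ?_
    have h := dvd_add h₂ (hdvd.mul_left 10)
    rwa [show n - 10 * s + 10 * s = n by omega] at h
  rw [hs.gcd_eq_one] at hd
  exact Nat.dvd_one.mp hd

theorem mem_A_of_prime {n p : ℕ} (hp : p.Prime) (hlow : n < 11 * p) (hupp : 32 * p < 3 * n) :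
    n ∈ A := by
  refine mem_A_of_coprime hlow hupp (hp.coprime_iff_not_dvd.mpr ?_)
  rintro ⟨c, rfl⟩
  have h₁ : c < 11 := by nlinarith
  have h₂ : 10 < c := by
    by_contra! hc
    nlinarith
  omega

theorem mem_A_of_lt_six_thousand {n : ℕ} (h : 1674 < n) (hn : n < 6000) : n ∈ A := by
  have key : ∀ j < 80, ∀ k < 80, 1674 < 80 * j + k → 80 * j + k < 6000 →
      ∃ i < 20, 32 * ((80 * j + k) / 11 + 1 + i) < 3 * (80 * j + k) ∧
        ((80 * j + k) / 11 + 1 + i).Coprime (80 * j + k) := by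
    decide +kernel
  have hdiv := Nat.div_add_mod n 80
  obtain ⟨i, -, hi, hc⟩ := key (n / 80) (by omega) (n % 80) (by omega) (by omega) (by omega)
  rw [hdiv] at hi hc
  exact mem_A_of_coprime (by omega) hi hc

/-- Primes increasing by a factor less than `33 / 32` at each step. -/
def chainPrimes : List ℕ :=
  [547, 563, 577, 593, 607, 619, 631, 647, 661, 677, 691, 709, 727, 743, 761, 773, 797, 821, 839,
   863, 887, 911, 937, 953, 977, 997, 1021, 1051, 1069, 1097, 1129, 1163, 1193, 1229, 1259, 1297,
   1327, 1367, 1409, 1453, 1493, 1531, 1571, 1619, 1669, 1721, 1759, 1811, 1867, 1913, 1951,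
   2011, 2069, 2131, 2179, 2243, 2311, 2383, 2447, 2521, 2593, 2671, 2753, 2837, 2917, 3001,
   3089, 3181, 3271, 3373, 3469, 3571, 3677, 3779, 3889, 4007, 4129, 4253, 4373, 4507, 4643,
   4787, 4933, 5087, 5237, 5399, 5563, 5717, 5881, 6053, 6229, 6421, 6619, 6823, 7027, 7243,
   7459, 7691, 7927, 8171, 8423, 8681, 8951, 9227, 9511, 9803, 10103, 10399, 10723, 11057, 11399,
   11743, 12109, 12487, 12853, 13249, 13649, 14071, 14503, 14951, 15413, 15889, 16381, 16889,
   17401, 17939, 18493, 19069, 19661, 20269, 20899, 21529, 22193, 22877, 23581, 24317, 25073,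
   25849, 26647, 27479, 28319, 29201, 30113, 31051, 32009, 32999, 34019, 35081, 36161, 37277,
   38431, 39631, 40867, 42139, 43451, 44797, 46187, 47629, 49117, 50651, 52223, 53849, 55529,
   57259, 59029, 60869, 62761, 64717, 66739, 68821, 70969, 73181, 75437, 77783, 80209, 82699,
   85259, 87917, 90659, 93491, 96401, 99409, 102503, 105701, 109001, 112403, 115903, 119513,
   123239, 127081, 131041, 135131, 139343, 143687, 148171, 152791, 157561, 162473, 167543,
   172759, 178151, 183713, 189439, 195353, 201451, 207743, 214219, 220907, 227797, 234907,
   242243, 249811, 257611, 265621, 273919, 282461, 291287, 300367, 309737, 319411, 329387, 339679]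

set_option maxRecDepth 10000 in
theorem prime_of_mem_chainPrimes : ∀ p ∈ chainPrimes, p.Prime := by
  simp only [chainPrimes, List.forall_mem_cons]
  norm_num

theorem isChain_chainPrimes : chainPrimes.IsChain fun p q => 32 * q < 33 * p := by
  decide +kernel

theorem exists_mem_of_isChain {n a : ℕ} {l : List ℕ}
    (hl : (a :: l).IsChain fun p q => 32 * q < 33 * p) (ha : 32 * a < 3 * n)
    (hlast : n < 11 * (a :: l).getLast (by simp)) :
    ∃ p ∈ a :: l, n < 11 * p ∧ 32 * p < 3 * n := by
  induction l generalizing a with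
  | nil => exact ⟨a, by simp, by simpa using hlast, ha⟩
  | cons b l ih =>
    by_cases hna : n < 11 * a
    · exact ⟨a, by simp, hna, ha⟩
    · rw [List.isChain_cons_cons] at hl
      obtain ⟨p, hp, h⟩ := ih hl.2 (by omega) (by simpa using hlast)
      exact ⟨p, List.mem_cons_of_mem _ hp, h⟩

theorem mem_A_of_le_chainPrimes {n : ℕ} (h : 6000 ≤ n) (hn : n ≤ 3720000) : n ∈ A := by
  have hlast : 3720000 < 11 * chainPrimes.getLast (by simp [chainPrimes]) := by decide +kernel
  obtain ⟨p, hp, h₁, h₂⟩ := exists_mem_of_isChain (n := n) isChain_chainPrimes (by omega)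
    (hn.trans_lt hlast)
  exact mem_A_of_prime (prime_of_mem_chainPrimes p hp) h₁ h₂

theorem card_filter_dvd_Ioc_floor {S : Finset ℕ} {p : ℕ} (hS : ∀ q ∈ S, q.Prime) (hp : p.Prime)
    (hpS : p ∉ S) (x y : ℝ) :
    (((Finset.Ioc ⌊x⌋₊ ⌊y⌋₊).filter fun s => ∀ q ∈ S, ¬ q ∣ s).filter fun s => p ∣ s).card =
      ((Finset.Ioc ⌊x / p⌋₊ ⌊y / p⌋₊).filter fun s => ∀ q ∈ S, ¬ q ∣ s).card := by
  symm
  refine Finset.card_bij (fun t _ => p * t) ?_ ?_ ?_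
  · intro t ht
    simp only [Finset.mem_filter, Finset.mem_Ioc, Nat.floor_div_natCast,
      Nat.div_lt_iff_lt_mul hp.pos, Nat.le_div_iff_mul_le hp.pos] at ht ⊢
    refine ⟨⟨by simpa only [mul_comm p] using ht.1, fun q hq hqt => ?_⟩, dvd_mul_right p t⟩
    rcases (hS q hq).dvd_mul.mp hqt with h | h
    · exact hpS ((Nat.prime_dvd_prime_iff_eq (hS q hq) hp).mp h ▸ hq)
    · exact ht.2 q hq h
  · intro t _ u _ h
    exact Nat.eq_of_mul_eq_mul_left hp.pos h
  · intro s hs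
    obtain ⟨hs, t, rfl⟩ := Finset.mem_filter.mp hs
    refine ⟨t, ?_, rfl⟩
    simp only [Finset.mem_filter, Finset.mem_Ioc, Nat.floor_div_natCast,
      Nat.div_lt_iff_lt_mul hp.pos, Nat.le_div_iff_mul_le hp.pos] at hs ⊢
    exact ⟨by simpa only [mul_comm p] using hs.1, fun q hq h => hs.2 q hq (h.mul_left p)⟩

/-- The Legendre sieve on an interval. -/
theorem abs_card_sieve_sub_le (S : Finset ℕ) (hS : ∀ q ∈ S, q.Prime) {x y : ℝ} (hx : 0 ≤ x)
    (hxy : x ≤ y) :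
    |(((Finset.Ioc ⌊x⌋₊ ⌊y⌋₊).filter fun s => ∀ q ∈ S, ¬ q ∣ s).card : ℝ) -
      (y - x) * ∏ q ∈ S, (1 - 1 / (q : ℝ))| ≤ 2 ^ S.card := by
  induction S using Finset.induction_on generalizing x y with
  | empty =>
    have hfl := Nat.floor_le_floor hxy
    have h₁ := Nat.floor_le hx
    have h₂ := Nat.floor_le (hx.trans hxy)
    have h₃ := Nat.lt_floor_add_one x
    have h₄ := Nat.lt_floor_add_one y
    simp only [Finset.notMem_empty, false_imp_iff, implies_true, Finset.filter_true,
      Nat.card_Ioc, Nat.cast_sub hfl, Finset.prod_empty, Finset.card_empty, pow_zero, mul_one]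
    rw [abs_le]
    constructor <;> linarith
  | insert p S hpS ih =>
    have hS' : ∀ q ∈ S, q.Prime := fun q hq => hS q (Finset.mem_insert_of_mem hq)
    have hp : p.Prime := hS p (Finset.mem_insert_self p S)
    have hp0 : (0 : ℝ) ≤ p := p.cast_nonneg
    have hsplit := Finset.card_filter_add_card_filter_not
      (s := (Finset.Ioc ⌊x⌋₊ ⌊y⌋₊).filter fun s => ∀ q ∈ S, ¬ q ∣ s) (fun s => p ∣ s)
    have hins : ((Finset.Ioc ⌊x⌋₊ ⌊y⌋₊).filter fun s => ∀ q ∈ insert p S, ¬ q ∣ s) =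
        ((Finset.Ioc ⌊x⌋₊ ⌊y⌋₊).filter fun s => ∀ q ∈ S, ¬ q ∣ s).filter fun s => ¬ p ∣ s := by
      ext s
      simp only [Finset.mem_filter, Finset.forall_mem_insert]
      tauto
    rw [card_filter_dvd_Ioc_floor hS' hp hpS, ← hins] at hsplit
    have hcast := congrArg (Nat.cast : ℕ → ℝ) hsplit
    rw [Nat.cast_add] at hcast
    have h₁ := abs_le.mp (ih hS' hx hxy)
    have h₂ := abs_le.mp (ih hS' (div_nonneg hx hp0) (div_le_div_of_nonneg_right hxy hp0))
    rw [Finset.prod_insert hpS, Finset.card_insert_of_notMem hpS, pow_succ, abs_le]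
    have hmain : (y - x) * ((1 - 1 / (p : ℝ)) * ∏ q ∈ S, (1 - 1 / (q : ℝ))) =
        (y - x) * ∏ q ∈ S, (1 - 1 / (q : ℝ)) -
          (y / p - x / p) * ∏ q ∈ S, (1 - 1 / (q : ℝ)) := by ring
    rw [hmain]
    constructor <;> linarith [h₁.1, h₁.2, h₂.1, h₂.2]

theorem one_div_thirty_le_prod (S : Finset ℕ) (hS : ∀ q ∈ S, q.Prime) :
    (1 / 30 : ℝ) ≤ ∏ q ∈ S, (q : ℝ) * ((1 - 1 / (q : ℝ)) / 2) ^ 2 := by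
  let f : ℕ → ℝ := fun q => q * ((1 - 1 / (q : ℝ)) / 2) ^ 2
  have hf : ∀ q, 0 ≤ f q := fun q => by positivity
  have hlarge : ∀ q ∈ S, q ∉ ({2, 3, 5} : Finset ℕ) → 1 ≤ f q := by
    intro q hq hq'
    have hq6 : 6 ≤ q := by
      have hprime := hS q hq
      by_contra! hlt
      interval_cases q <;> revert hprime hq' <;> decide
    have hq6' : (6 : ℝ) ≤ q := by exact_mod_cast hq6
    have hfq : f q = (q - 1) ^ 2 / (4 * q) := by
      simp only [f]
      field_simp
      ring
    rw [hfq, le_div_iff₀ (by positivity)]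
    nlinarith
  have hsmall : ∀ q ∈ ({2, 3, 5} : Finset ℕ), f q ≤ 1 := by
    intro q hq
    simp only [Finset.mem_insert, Finset.mem_singleton] at hq
    rcases hq with rfl | rfl | rfl <;> norm_num [f]
  calc (1 / 30 : ℝ) = ∏ q ∈ ({2, 3, 5} : Finset ℕ), f q := by norm_num [f]
    _ ≤ ∏ q ∈ S ∩ {2, 3, 5}, f q :=
        Finset.prod_le_prod_of_subset_of_le_one Finset.inter_subset_right (fun q _ => hf q)
          fun q hq _ => hsmall q hq
    _ ≤ (∏ q ∈ S ∩ {2, 3, 5}, f q) * ∏ q ∈ S \ {2, 3, 5}, f q := by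
        refine le_mul_of_one_le_right (Finset.prod_nonneg fun q _ => hf q) ?_
        exact Finset.one_le_prod fun q hq =>
          hlarge q (Finset.mem_sdiff.mp hq).1 (Finset.mem_sdiff.mp hq).2
    _ = ∏ q ∈ S, f q := Finset.prod_inter_mul_prod_sdiff S {2, 3, 5} f

theorem mem_A_of_large {n : ℕ} (hn : 3720000 < n) : n ∈ A := by
  have hn' : (3720000 : ℝ) < n := by exact_mod_cast hn
  have hprime : ∀ q ∈ n.primeFactors, q.Prime := fun q => Nat.prime_of_mem_primeFactors
  set P : ℝ := ∏ q ∈ n.primeFactors, (1 - 1 / (q : ℝ)) / 2 with hP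
  have hP0 : 0 ≤ P := Finset.prod_nonneg fun q hq => by
    have h1 : (1 : ℝ) ≤ q := by exact_mod_cast (hprime q hq).one_le
    have := (div_le_one (by linarith)).mpr h1
    linarith
  have hnP : 1 / 30 ≤ n * P ^ 2 := by
    refine (one_div_thirty_le_prod _ hprime).trans ?_
    rw [Finset.prod_mul_distrib, Finset.prod_pow, ← hP]
    refine mul_le_mul_of_nonneg_right ?_ (sq_nonneg P)
    rw [← Nat.cast_prod]
    exact Nat.cast_le.mpr (Nat.le_of_dvd (by omega) (Nat.prod_primeFactors_dvd n))
  have hLP : 1 < ((3 * n - 1) / 32 - n / 11 : ℝ) * P := by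
    have hL : (30 * n : ℝ) < ((3 * n - 1) / 32 - n / 11 : ℝ) ^ 2 := by nlinarith
    have hLpos : 0 < ((3 * n - 1) / 32 - n / 11 : ℝ) := by linarith
    have hPpos : 0 < P ^ 2 := by
      by_contra! h
      nlinarith
    refine lt_of_pow_lt_pow_left₀ 2 (by positivity) ?_
    rw [mul_pow]
    nlinarith
  have hsieve := (abs_le.mp (abs_card_sieve_sub_le n.primeFactors hprime
    (x := n / 11) (y := (3 * n - 1) / 32) (by positivity) (by linarith))).1
  have hprod : ∏ q ∈ n.primeFactors, (1 - 1 / (q : ℝ)) = 2 ^ n.primeFactors.card * P := by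
    rw [hP, Finset.prod_div_distrib, Finset.prod_const]
    field_simp
  rw [hprod] at hsieve
  have hpow : (0 : ℝ) < 2 ^ n.primeFactors.card := by positivity
  have hcard : (0 : ℝ) < ((Finset.Ioc ⌊(n / 11 : ℝ)⌋₊ ⌊((3 * n - 1) / 32 : ℝ)⌋₊).filter
      fun s => ∀ q ∈ n.primeFactors, ¬ q ∣ s).card := by
    nlinarith [mul_lt_mul_of_pos_left hLP hpow]
  obtain ⟨s, hs⟩ := Finset.card_pos.mp (Nat.cast_pos.mp hcard)
  simp only [Finset.mem_filter, Finset.mem_Ioc] at hs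
  obtain ⟨⟨hlow, hupp⟩, hs⟩ := hs
  rw [Nat.floor_lt (by positivity), div_lt_iff₀ (by norm_num)] at hlow
  rw [Nat.le_floor_iff (by linarith), le_div_iff₀ (by norm_num)] at hupp
  refine mem_A_of_coprime (s := s) ?_ ?_ (Nat.coprime_of_dvd fun q hq hqs hqn => ?_)
  · exact_mod_cast (by linarith : (n : ℝ) < 11 * s)
  · exact_mod_cast (by linarith : (32 * s : ℝ) < 3 * n)
  · exact hs q (Nat.mem_primeFactors.mpr ⟨hq, hqn, by omega⟩) hqs

theorem stmt_2 (n : ℕ) (h : 1674 < n) : n ∈ A := by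
  rcases lt_or_ge n 6000 with h₁ | h₁
  · exact mem_A_of_lt_six_thousand h h₁
  rcases le_or_gt n 3720000 with h₂ | h₂
  · exact mem_A_of_le_chainPrimes h₁ h₂
  · exact mem_A_of_large h₂
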